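/- arXiv:0908.3111 — 7 statements merged into one kernel-verified Lean document; each statement's English description precedes it below -/
import Mathlib

section
/- Let G be a finite simple graph with an edge e, and let T be a tubing of G. Then Θ_e(T) is a tubing of the graph G − e, and the number of tubes of Θ_e(T) is greater than or equal to the number of tubes of T. -/
/-- A tube of a graph `G`: a nonempty set of vertices whose induced subgraph is connected. -/
def IsTube {V : Type*} (G : SimpleGraph V) (t : Set V) : Prop :=
  t.Nonempty ∧ (G.induce t).Connected

/-- Two tubes are compatible if they are nested or their union is not a tube (far apart). -/
def TubeCompatible {V : Type*} (G : SimpleGraph V) (t u : Set V) : Prop :=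
  t ⊆ u ∨ u ⊆ t ∨ ¬ IsTube G (t ∪ u)

/-- A tubing of `G`: a set of pairwise compatible proper tubes which, when `G` is
disconnected, does not contain every connected-component vertex set of `G`. -/
def IsTubing {V : Type*} (G : SimpleGraph V) (T : Set (Set V)) : Prop :=
  (∀ t ∈ T, IsTube G t ∧ t ≠ Set.univ) ∧
  (∀ t ∈ T, ∀ u ∈ T, TubeCompatible G t u) ∧
  (¬ G.Preconnected → ¬ ∀ c : G.ConnectedComponent, c.supp ∈ T)

/-- The vertex set of the connected component, within the induced subgraph of `H` on `t`,
containing the vertex `v` of `t`. -/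
def compSet {V : Type*} (H : SimpleGraph V) (t : Set V) (v : t) : Set V :=
  Subtype.val '' {w : t | (H.induce t).Reachable v w}

/-- The projection sending a collection `T` of subsets of vertices to the collection of all
vertex sets of connected components (in the graph `H`) of members of `T`. -/
def Theta {V : Type*} (H : SimpleGraph V) (T : Set (Set V)) : Set (Set V) :=
  {c | ∃ t ∈ T, ∃ v : t, c = compSet H t v}

section TubeLemmas

variable {V : Type*} {G H : SimpleGraph V} {s t u : Set V}

theorem IsTube.mono (hHG : H ≤ G) (ht : IsTube H t) : IsTube G t :=
  ⟨ht.1, ht.2.mono fun _ _ h => hHG h⟩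

theorem IsTube.union (hs : IsTube G s) (ht : IsTube G t) (h : (s ∩ t).Nonempty) :
    IsTube G (s ∪ t) :=
  ⟨hs.1.mono Set.subset_union_left,
    SimpleGraph.induce_union_connected hs.2.preconnected ht.2.preconnected h⟩

theorem IsTube.subset_supp (hs : IsTube G s) {v : V} (hv : v ∈ s) :
    s ⊆ (G.connectedComponentMk v).supp := by
  intro w hw
  rw [SimpleGraph.ConnectedComponent.mem_supp_iff, SimpleGraph.ConnectedComponent.eq]
  exact (hs.2.preconnected ⟨w, hw⟩ ⟨v, hv⟩).map (SimpleGraph.Embedding.induce s).toHom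

theorem SimpleGraph.ConnectedComponent.isTube_supp (c : G.ConnectedComponent) :
    IsTube G c.supp :=
  ⟨c.nonempty_supp, c.connected_toSimpleGraph⟩

theorem mem_compSet_self (v : t) : (v : V) ∈ compSet H t v :=
  ⟨v, SimpleGraph.Reachable.refl _, rfl⟩

theorem compSet_subset (v : t) : compSet H t v ⊆ t := by
  rintro _ ⟨w, -, rfl⟩
  exact w.2

theorem isTube_compSet (v : t) : IsTube H (compSet H t v) := by
  refine ⟨⟨v, mem_compSet_self v⟩, ?_⟩
  refine SimpleGraph.induce_connected_of_patches v (mem_compSet_self v) ?_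
  rintro _ ⟨w, ⟨p⟩, rfl⟩
  let q := p.map (SimpleGraph.Embedding.induce t).toHom
  refine ⟨{x | x ∈ q.support}, ?_, q.start_mem_support, q.end_mem_support,
    q.connected_induce_support.preconnected _ _⟩
  intro x hx
  obtain ⟨y, hy, rfl⟩ := List.mem_map.1 (SimpleGraph.Walk.support_map .. ▸ hx)
  classical exact ⟨y, (p.takeUntil y hy).reachable, rfl⟩

/-- A component of `t` contains every tube inside `t` that it meets. -/
theorem IsTube.subset_compSet (hs : IsTube H s) (hst : s ⊆ t) {v : t}
    (h : (compSet H t v ∩ s).Nonempty) : s ⊆ compSet H t v := by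
  have hu := (isTube_compSet v).union hs h
  have hut : compSet H t v ∪ s ⊆ t := Set.union_subset (compSet_subset v) hst
  intro w hw
  exact ⟨⟨w, hst hw⟩, (hu.2.preconnected ⟨v, Or.inl (mem_compSet_self v)⟩ ⟨w, Or.inr hw⟩).map
    (SimpleGraph.induceHomOfLE H hut).toHom, rfl⟩

/-- A tube of `G` has at most two components after the deletion of an edge. -/
theorem IsTube.exists_eq_compSet_union (ht : IsTube G t) (e : Sym2 V) :
    ∃ v w : t, t = compSet (G.deleteEdges {e}) t v ∪ compSet (G.deleteEdges {e}) t w := by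
  suffices h : ∃ v w : t, ∀ x : t, ((G.deleteEdges {e}).induce t).Reachable v x ∨
      ((G.deleteEdges {e}).induce t).Reachable w x by
    obtain ⟨v, w, h⟩ := h
    refine ⟨v, w, Set.Subset.antisymm (fun x hx => ?_)
      (Set.union_subset (compSet_subset v) (compSet_subset w))⟩
    exact (h ⟨x, hx⟩).imp (fun h => ⟨_, h, rfl⟩) (fun h => ⟨_, h, rfl⟩)
  have key : ∀ v w : t, (∀ x y : t, G.Adj x y → s(x.1, y.1) = e → y = v ∨ y = w) →
      ∀ x : t, ((G.deleteEdges {e}).induce t).Reachable v x ∨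
        ((G.deleteEdges {e}).induce t).Reachable w x := by
    intro v w hvw x
    obtain ⟨p⟩ := ht.2.preconnected v x
    suffices h : ∀ (x y : t) (p : (G.induce t).Walk x y),
        (((G.deleteEdges {e}).induce t).Reachable v x ∨
          ((G.deleteEdges {e}).induce t).Reachable w x) →
        (((G.deleteEdges {e}).induce t).Reachable v y ∨
          ((G.deleteEdges {e}).induce t).Reachable w y) from h v x p (Or.inl (.refl _))
    intro x y p
    induction p with
    | nil => exact id
    | @cons x y z hxy p ih =>
      intro hx
      apply ih
      by_cases hxe : s(x.1, y.1) = e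
      · rcases hvw x y hxy hxe with rfl | rfl
        · exact Or.inl (.refl _)
        · exact Or.inr (.refl _)
      · have hadj : ((G.deleteEdges {e}).induce t).Adj x y := by
          simpa [SimpleGraph.deleteEdges_adj, hxe] using hxy
        exact hx.imp (·.trans hadj.reachable) (·.trans hadj.reachable)
  by_cases h : ∃ x y : t, s(x.1, y.1) = e
  · obtain ⟨v, w, rfl⟩ := h
    refine ⟨v, w, key v w fun x y _ hxy => ?_⟩
    rcases Sym2.eq_iff.1 hxy with ⟨-, h⟩ | ⟨-, h⟩
    · exact Or.inr (Subtype.ext h)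
    · exact Or.inl (Subtype.ext h)
  · obtain ⟨v, hv⟩ := ht.1
    exact ⟨⟨v, hv⟩, ⟨v, hv⟩, key _ _ fun x y _ hxy => (h ⟨x, y, hxy⟩).elim⟩

/-- If each component of a tube `t` in `G - e` is covered by a member of a pairwise compatible
family contained in `t`, then `t` belongs to the family. -/
theorem IsTube.mem_of_forall_compSet_subset (ht : IsTube G t) (e : Sym2 V) {T : Set (Set V)}
    (hT : ∀ t ∈ T, ∀ u ∈ T, TubeCompatible G t u)
    (h : ∀ v : t, ∃ X ∈ T, compSet (G.deleteEdges {e}) t v ⊆ X ∧ X ⊆ t) : t ∈ T := by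
  obtain ⟨v, w, hvw⟩ := ht.exists_eq_compSet_union e
  obtain ⟨X, hX, hvX, hXt⟩ := h v
  obtain ⟨Y, hY, hwY, hYt⟩ := h w
  have hXY : X ∪ Y = t :=
    (Set.union_subset hXt hYt).antisymm (hvw.subset.trans (Set.union_subset_union hvX hwY))
  rcases hT X hX Y hY with h | h | h
  · rwa [← hXY, Set.union_eq_self_of_subset_left h]
  · rwa [← hXY, Set.union_eq_self_of_subset_right h]
  · exact (h (hXY ▸ ht)).elim

theorem TubeCompatible.compSet_compSet (hHG : H ≤ G) (ht : IsTube G t) (hu : IsTube G u)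
    (h : TubeCompatible G t u) (v : t) (w : u) :
    TubeCompatible H (compSet H t v) (compSet H u w) := by
  by_cases hcd : IsTube H (compSet H t v ∪ compSet H u w)
  swap
  · exact Or.inr (Or.inr hcd)
  rcases h with h | h | h
  · refine Or.inl (Set.subset_union_left.trans (hcd.subset_compSet
      (Set.union_subset ((compSet_subset v).trans h) (compSet_subset w)) ?_))
    exact ⟨w, mem_compSet_self w, Or.inr (mem_compSet_self w)⟩
  · refine Or.inr (Or.inl (Set.subset_union_right.trans (hcd.subset_compSet
      (Set.union_subset (compSet_subset v) ((compSet_subset w).trans h)) ?_)))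
    exact ⟨v, mem_compSet_self v, Or.inl (mem_compSet_self v)⟩
  · refine (h ?_).elim
    have h₁ := ht.union (hcd.mono hHG) ⟨v, v.2, Or.inl (mem_compSet_self v)⟩
    have h₂ := h₁.union hu ⟨w, Or.inr (Or.inr (mem_compSet_self w)), w.2⟩
    have hsub : compSet H t v ∪ compSet H u w ⊆ t ∪ u :=
      Set.union_subset_union (compSet_subset v) (compSet_subset w)
    convert h₂ using 1
    grind

end TubeLemmas

theorem IsTubing.theta_deleteEdges {V : Type*} {G : SimpleGraph V} {T : Set (Set V)}
    (hT : IsTubing G T) (e : Sym2 V) :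
    IsTubing (G.deleteEdges {e}) (Theta (G.deleteEdges {e}) T) := by
  obtain ⟨htube, hcompat, hcomp⟩ := hT
  have hle : G.deleteEdges {e} ≤ G := G.deleteEdges_le {e}
  refine ⟨?_, ?_, fun hH hall => ?_⟩
  · rintro _ ⟨t, ht, v, rfl⟩
    refine ⟨isTube_compSet v, fun h => (htube t ht).2 ?_⟩
    exact Set.univ_subset_iff.1 (h ▸ compSet_subset v)
  · rintro _ ⟨t, ht, v, rfl⟩ _ ⟨u, hu, w, rfl⟩
    exact (hcompat t ht u hu).compSet_compSet hle (htube t ht).1 (htube u hu).1 v w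
  · have hmem : ∀ c : G.ConnectedComponent, c.supp ∈ T := by
      intro c
      refine c.isTube_supp.mem_of_forall_compSet_subset e hcompat fun v => ?_
      obtain ⟨X, hX, w, hw⟩ := hall ((G.deleteEdges {e}).connectedComponentMk v)
      have hsub : ((G.deleteEdges {e}).connectedComponentMk v).supp ⊆ X :=
        hw ▸ compSet_subset w
      refine ⟨X, hX, ((isTube_compSet v).subset_supp (mem_compSet_self v)).trans hsub, ?_⟩
      have hXv := (htube X hX).1.subset_supp
        (hsub SimpleGraph.ConnectedComponent.connectedComponentMk_mem)
      rwa [show G.connectedComponentMk v = c from v.2] at hXv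
    by_cases hG : G.Preconnected
    · obtain ⟨v⟩ : Nonempty V := by
        by_contra h
        exact hH fun v => (h ⟨v⟩).elim
      refine (htube _ (hmem (G.connectedComponentMk v))).2 (Set.eq_univ_of_forall fun w => ?_)
      exact SimpleGraph.ConnectedComponent.sound (hG w v)
    · exact hcomp hG hmem

theorem IsTubing.ncard_le_ncard_theta {V : Type*} [Finite V] {G : SimpleGraph V}
    {T : Set (Set V)} (hT : IsTubing G T) (e : Sym2 V) :
    T.ncard ≤ (Theta (G.deleteEdges {e}) T).ncard := by
  obtain ⟨htube, hcompat, -⟩ := hT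
  have hex : ∀ t ∈ T, ∃ c ∈ Theta (G.deleteEdges {e}) T, c.Nonempty ∧ c ⊆ t ∧
      ∀ X ∈ T, c ⊆ X → X ⊆ t → X = t := by
    intro t ht
    by_contra! h
    refine ((htube t ht).1.mem_of_forall_compSet_subset e (T := T \ {t})
      (fun x hx y hy => hcompat x hx.1 y hy.1) fun v => ?_).2 rfl
    obtain ⟨X, hX, hvX, hXt, hne⟩ :=
      h _ ⟨t, ht, v, rfl⟩ ⟨v, mem_compSet_self v⟩ (compSet_subset v)
    exact ⟨X, ⟨hX, hne⟩, hvX, hXt⟩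
  choose! f hmem hne hsub hmax using hex
  refine Set.ncard_le_ncard_of_injOn f hmem (fun s hs t ht hst => ?_) (Set.toFinite _)
  have hfs : f s ⊆ t := hst ▸ hsub t ht
  have hft : f t ⊆ s := hst ▸ hsub s hs
  rcases hcompat s hs t ht with h | h | h
  · exact hmax t ht s hs hft h
  · exact (hmax s hs t ht hfs h).symm
  · exact (h ((htube s hs).1.union (htube t ht).1
      ((hne s hs).mono (Set.subset_inter (hsub s hs) hfs)))).elim

/-- For a finite simple graph `G` with an edge `e` and a tubing `T` of `G`,
`Θ_e(T)` is a tubing of `G − e` with at least as many tubes as `T`. -/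
theorem theta_isTubing_and_card_le {V : Type*} [Fintype V] (G : SimpleGraph V)
    (e : Sym2 V) (he : e ∈ G.edgeSet) (T : Set (Set V)) (hT : IsTubing G T) :
    IsTubing (G.deleteEdges {e}) (Theta (G.deleteEdges {e}) T) ∧
      T.ncard ≤ (Theta (G.deleteEdges {e}) T).ncard :=
  ⟨hT.theta_deleteEdges e, hT.ncard_le_ncard_theta e⟩
end

section
/- Let p, q ≥ 1, let u ∈ S_p and v ∈ S_q be permutations, let S ⊆ {1,…,p+q} be a p-element subset with order-preserving bijections ι : {1,…,p} → S and ι̂ : {1,…,q} → {1,…,p+q} ∖ S, and let σ ∈ S_{p+q} be the associated (p,q)-shuffle. Set w = (u × v) ∘ σ^{-1} ∈ S_{p+q}. Then for every 1 ≤ m ≤ p one has w^{-1}({1,…,m}) = ι(u^{-1}({1,…,m})), and for every 1 ≤ m ≤ q one has w^{-1}({1,…,p+m}) = S ∪ ι̂(v^{-1}({1,…,m})). (This identifies each term F_{(u×v)·σ^{-1}} of the Malvenuto–Reutenauer product in SSym with the tubing ρ̂_ι(u,v) of the complete graph obtained by including u on the nodes S and v, expanded by S, on the remaining nodes, under the Devadoss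 bijection sending a permutation w to the chain of tubes w^{-1}({1,…,m}).) -/
/-- The permutation `u × v ∈ S_{p+q}`, acting as `u` on the first `p` values and as
`v` (shifted by `p`) on the last `q` values. -/
def permProd {p q : ℕ} (u : Equiv.Perm (Fin p)) (v : Equiv.Perm (Fin q)) :
    Equiv.Perm (Fin (p + q)) :=
  (finSumFinEquiv.symm).trans ((Equiv.sumCongr u v).trans finSumFinEquiv)

@[simp]
theorem permProd_castAdd {p q : ℕ} (u : Equiv.Perm (Fin p)) (v : Equiv.Perm (Fin q))
    (i : Fin p) : permProd u v (Fin.castAdd q i) = Fin.castAdd q (u i) := by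
  simp [permProd]

@[simp]
theorem permProd_natAdd {p q : ℕ} (u : Equiv.Perm (Fin p)) (v : Equiv.Perm (Fin q))
    (j : Fin q) : permProd u v (Fin.natAdd p j) = Fin.natAdd p (v j) := by
  simp [permProd]

/-- Each term `(u × v) ∘ σ⁻¹` of the Malvenuto–Reutenauer product,
for `σ` the `(p,q)`-shuffle associated to a `p`-element subset `S` of `{1,…,p+q}`,
corresponds to the tubing `ρ̂_ι(u,v)` of the complete graph: its chain of tubes
`w⁻¹({1,…,m})` consists of the `ι`-images of the tubes of `u` followed by `S` and the
`S`-expanded `ι̂`-images of the tubes of `v`.  (Here `Fin n` encodes `{1,…,n}` via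
`i ↦ i+1`, so the set `{1,…,m}` is `{y | y.val < m}`.) -/
theorem shuffle_term_eq_facet_inclusion (p q : ℕ) (hp : 1 ≤ p) (hq : 1 ≤ q)
    (u : Equiv.Perm (Fin p)) (v : Equiv.Perm (Fin q))
    (S : Finset (Fin (p + q))) (hS : S.card = p) (hSc : Sᶜ.card = q)
    (σ : Equiv.Perm (Fin (p + q)))
    (hσ1 : ∀ i : Fin p, σ (Fin.castAdd q i) = ↑(S.orderIsoOfFin hS i))
    (hσ2 : ∀ j : Fin q, σ (Fin.natAdd p j) = ↑(Sᶜ.orderIsoOfFin hSc j)) :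
    (∀ m : ℕ, 1 ≤ m → m ≤ p →
      {x : Fin (p + q) | ((permProd u v * σ⁻¹) x).val < m} =
        (fun i : Fin p => (↑(S.orderIsoOfFin hS i) : Fin (p + q))) ''
          {i : Fin p | (u i).val < m}) ∧
    (∀ m : ℕ, 1 ≤ m → m ≤ q →
      {x : Fin (p + q) | ((permProd u v * σ⁻¹) x).val < p + m} =
        (↑S : Set (Fin (p + q))) ∪
          (fun j : Fin q => (↑(Sᶜ.orderIsoOfFin hSc j) : Fin (p + q))) ''
            {j : Fin q | (v j).val < m}) := by
  have mem_S (i : Fin p) : σ (Fin.castAdd q i) ∈ S := hσ1 i ▸ (S.orderIsoOfFin hS i).2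
  have notMem_S (j : Fin q) : σ (Fin.natAdd p j) ∉ S :=
    Finset.mem_compl.mp (hσ2 j ▸ (Sᶜ.orderIsoOfFin hSc j).2)
  have castAdd_ne (i : Fin p) (j : Fin q) : Fin.castAdd q i ≠ Fin.natAdd p j := by
    simp only [ne_eq, Fin.ext_iff, Fin.val_castAdd, Fin.val_natAdd]
    lia
  simp only [← hσ1, ← hσ2]
  refine ⟨fun m _ hm => ?_, fun m _ _ => ?_⟩ <;> ext x <;>
    obtain ⟨y, rfl⟩ := σ.surjective x <;> induction y using Fin.addCases with
    | left i => simp [mem_S]; try lia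
    | right j => simp [notMem_S, castAdd_ne]; try lia
end

section
/- Let p, q, k, l ≥ 1, let u : {1,…,p} → {1,…,k} and v : {1,…,q} → {1,…,l} be surjections (ordered partitions), let S ⊆ {1,…,p+q} be a p-element subset with order-preserving bijections ι : {1,…,p} → S and ι̂ : {1,…,q} → {1,…,p+q} ∖ S, and let σ ∈ S_{p+q} be the associated (p,q)-shuffle. Define u × v : {1,…,p+q} → {1,…,k+l} by (u×v)(i) = u(i) for i ≤ p and (u×v)(p+j) = v(j) + k for 1 ≤ j ≤ q, and set w = (u × v) ∘ σ^{-1}. Then for every 1 ≤ m ≤ k one has w^{-1}({1,…,m}) = ι(u^{-1}({1,…,m})), and for every 1 ≤ m ≤ l one has w^{-1}({1,…,k+m}) = S ∪ ι̂(v^{-1}({1,…,m})). (This identifies each term of Chapoton's product of faces of permutohedra with the image of the pair (u, v) under the facet inclusion ρ̂_ι.) -/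
/-- The ordered-partition product `u × v : {1,…,p+q} → {1,…,k+l}`, acting as `u` on the
first `p` inputs and as `v` (with values shifted by `k`) on the last `q` inputs. -/
def mapProd {p q k l : ℕ} (u : Fin p → Fin k) (v : Fin q → Fin l) :
    Fin (p + q) → Fin (k + l) :=
  fun x => Sum.elim (fun i => Fin.castAdd l (u i)) (fun j => Fin.natAdd k (v j))
    (finSumFinEquiv.symm x)

theorem mapProd_castAdd {p q k l : ℕ} (u : Fin p → Fin k) (v : Fin q → Fin l) (i : Fin p) :
    mapProd u v (Fin.castAdd q i) = Fin.castAdd l (u i) := by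
  simp [mapProd]

theorem mapProd_natAdd {p q k l : ℕ} (u : Fin p → Fin k) (v : Fin q → Fin l) (j : Fin q) :
    mapProd u v (Fin.natAdd p j) = Fin.natAdd k (v j) := by
  simp [mapProd]

/-- Each term `(u × v) ∘ σ⁻¹` of Chapoton's product of faces of
permutohedra (ordered partitions encoded as surjections), for `σ` the `(p,q)`-shuffle
associated to a `p`-element subset `S` of `{1,…,p+q}`, has blocks-chain
`w⁻¹({1,…,m})` given by the `ι`-images of the blocks-chain of `u` followed by `S` and
the `S`-expanded `ι̂`-images of the blocks-chain of `v`.  (Here `Fin n` encodes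
`{1,…,n}` via `i ↦ i+1`, so the set `{1,…,m}` is `{y | y.val < m}`.) -/
theorem shuffle_term_eq_facet_inclusion_faces (p q k l : ℕ)
    (hp : 1 ≤ p) (hq : 1 ≤ q) (hk : 1 ≤ k) (hl : 1 ≤ l)
    (u : Fin p → Fin k) (v : Fin q → Fin l)
    (hu : Function.Surjective u) (hv : Function.Surjective v)
    (S : Finset (Fin (p + q))) (hS : S.card = p) (hSc : Sᶜ.card = q)
    (σ : Equiv.Perm (Fin (p + q)))
    (hσ1 : ∀ i : Fin p, σ (Fin.castAdd q i) = ↑(S.orderIsoOfFin hS i))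
    (hσ2 : ∀ j : Fin q, σ (Fin.natAdd p j) = ↑(Sᶜ.orderIsoOfFin hSc j)) :
    (∀ m : ℕ, 1 ≤ m → m ≤ k →
      {x : Fin (p + q) | (mapProd u v (σ⁻¹ x)).val < m} =
        (fun i : Fin p => (↑(S.orderIsoOfFin hS i) : Fin (p + q))) ''
          {i : Fin p | (u i).val < m}) ∧
    (∀ m : ℕ, 1 ≤ m → m ≤ l →
      {x : Fin (p + q) | (mapProd u v (σ⁻¹ x)).val < k + m} =
        (↑S : Set (Fin (p + q))) ∪
          (fun j : Fin q => (↑(Sᶜ.orderIsoOfFin hSc j) : Fin (p + q))) ''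
            {j : Fin q | (v j).val < m}) := by
  have hmem (i : Fin p) : σ (Fin.castAdd q i) ∈ S := hσ1 i ▸ (S.orderIsoOfFin hS i).2
  have hnotMem (j : Fin q) : σ (Fin.natAdd p j) ∉ S :=
    Finset.mem_compl.mp (hσ2 j ▸ (Sᶜ.orderIsoOfFin hSc j).2)
  simp only [← hσ1, ← hσ2]
  refine ⟨fun m _ hm => ?_, fun m _ _ => ?_⟩ <;> ext x <;>
    obtain ⟨y, rfl⟩ := σ.surjective x <;>
    induction y using Fin.addCases with
    | left i => ?_
    | right j => ?_
  · simp [mapProd_castAdd]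
  · have hne (i : Fin p) : Fin.castAdd q i ≠ Fin.natAdd p j := fun h =>
      hnotMem j (h ▸ hmem i)
    simp [mapProd_natAdd, hne]
    omega
  · have := (u i).isLt
    simp [mapProd_castAdd, hmem]
    omega
  · simp [mapProd_natAdd, hnotMem]
end

section
/- The linear map θ : SSym → ΔSym determined by θ(1) = 1 and θ(F_u) = e^p_{u^{-1}(p)} for u ∈ S_p is an algebra homomorphism: for all p, q ≥ 1, u ∈ S_p and v ∈ S_q, one has Σ_σ e^{p+q}_{((u×v)∘σ^{-1})^{-1}(p+q)} = e^p_{u^{-1}(p)} · e^q_{v^{-1}(q)} in ΔSym, where the sum on the left runs over all (p,q)-shuffles σ ∈ S_{p+q}. -/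
/-- The index set for the basis of `ΔSym`: the basis vector `e^n_j` of the degree-`n`
component `ℚ^n` is indexed by `⟨n, j⟩` with `j : Fin n` (encoding `j+1 ∈ {1,…,n}`). -/
abbrev DIndex : Type := Σ n : ℕ, Fin n

/-- The graded vector space `ΔSym` (without its degree-0 unit adjoined). -/
abbrev DSpace : Type := DIndex →₀ ℚ

/-- The product of basis vectors: `e^p_j · e^q_l` is the sum over all `p`-element subsets
`S ⊆ {1,…,p+q}` of `e^{p+q}_{ι̂_S(l)}`, where `ι̂_S : {1,…,q} → {1,…,p+q} ∖ S` is the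
order-preserving bijection. -/
noncomputable def dBasisMul (x y : DIndex) : DSpace :=
  ∑ S ∈ (Finset.univ.filter fun S : Finset (Fin (x.1 + y.1)) => S.card = x.1).attach,
    Finsupp.single
      ⟨x.1 + y.1,
        ↑((S.1ᶜ).orderIsoOfFin
          (by have h := (Finset.mem_filter.mp S.2).2
              simp [Finset.card_compl, h]) y.2)⟩ (1 : ℚ)

/-- The bilinear extension of the basis product to all of `DSpace`. -/
noncomputable def dMul (a b : DSpace) : DSpace :=
  a.sum fun x ca => b.sum fun y cb => (ca * cb) • dBasisMul x y

/-- A `(p,q)`-shuffle: a permutation of `{1,…,p+q}` increasing on `{1,…,p}` and on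
`{p+1,…,p+q}`. -/
def IsShuffle (p q : ℕ) (σ : Equiv.Perm (Fin (p + q))) : Prop :=
  ∀ i j : Fin (p + q), i < j → (j.val < p ∨ p ≤ i.val) → σ i < σ j

instance (p q : ℕ) (σ : Equiv.Perm (Fin (p + q))) : Decidable (IsShuffle p q σ) := by
  unfold IsShuffle; infer_instance

/-- The shuffle sending `{1,…,p}` increasingly onto `S` and `{p+1,…,p+q}` increasingly onto the
complement of `S`. -/
def shuffleOfFinset {p q : ℕ} (S : Finset (Fin (p + q))) (hS : S.card = p) (hSc : Sᶜ.card = q) :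
    Equiv.Perm (Fin (p + q)) :=
  finSumFinEquiv.symm.trans (finSumEquivOfFinset hS hSc)

theorem shuffleOfFinset_castAdd {p q : ℕ} (S : Finset (Fin (p + q))) (hS : S.card = p)
    (hSc : Sᶜ.card = q) (i : Fin p) :
    shuffleOfFinset S hS hSc (Fin.castAdd q i) = S.orderEmbOfFin hS i := by
  simp [shuffleOfFinset]

theorem shuffleOfFinset_natAdd {p q : ℕ} (S : Finset (Fin (p + q))) (hS : S.card = p)
    (hSc : Sᶜ.card = q) (j : Fin q) :
    shuffleOfFinset S hS hSc (Fin.natAdd p j) = Sᶜ.orderEmbOfFin hSc j := by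
  simp [shuffleOfFinset]

theorem isShuffle_shuffleOfFinset {p q : ℕ} (S : Finset (Fin (p + q))) (hS : S.card = p)
    (hSc : Sᶜ.card = q) : IsShuffle p q (shuffleOfFinset S hS hSc) := by
  intro i j hij h
  induction i using Fin.addCases with
  | left i =>
    induction j using Fin.addCases with
    | left j =>
      rw [shuffleOfFinset_castAdd, shuffleOfFinset_castAdd]
      exact (S.orderEmbOfFin hS).strictMono hij
    | right j => simp at h; omega
  | right i =>
    induction j using Fin.addCases with
    | left j => simp [Fin.lt_def] at hij; omega
    | right j =>
      rw [shuffleOfFinset_natAdd, shuffleOfFinset_natAdd]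
      exact (Sᶜ.orderEmbOfFin hSc).strictMono (by simpa using hij)

/-- The set of values that a permutation of `{1,…,p+q}` takes on `{1,…,p}`. -/
def leftImage {p q : ℕ} (σ : Equiv.Perm (Fin (p + q))) : Finset (Fin (p + q)) :=
  Finset.univ.image fun i : Fin p => σ (Fin.castAdd q i)

theorem card_leftImage {p q : ℕ} (σ : Equiv.Perm (Fin (p + q))) : (leftImage σ).card = p :=
  (Finset.card_image_of_injective _ (σ.injective.comp (Fin.castAdd_injective p q))).trans
    (Finset.card_fin p)

theorem leftImage_shuffleOfFinset {p q : ℕ} (S : Finset (Fin (p + q))) (hS : S.card = p)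
    (hSc : Sᶜ.card = q) : leftImage (shuffleOfFinset S hS hSc) = S := by
  simp only [leftImage, shuffleOfFinset_castAdd]
  exact S.image_orderEmbOfFin_univ hS

theorem IsShuffle.eq_shuffleOfFinset {p q : ℕ} {σ : Equiv.Perm (Fin (p + q))}
    (hσ : IsShuffle p q σ) (hSc : (leftImage σ)ᶜ.card = q) :
    shuffleOfFinset (leftImage σ) (card_leftImage σ) hSc = σ := by
  ext1 k
  induction k using Fin.addCases with
  | left i =>
    rw [shuffleOfFinset_castAdd]
    refine (congrFun (Finset.orderEmbOfFin_unique (card_leftImage σ)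
      (f := fun i => σ (Fin.castAdd q i)) (fun i => ?_) fun i j hij => ?_) i).symm
    · simp [leftImage]
    · exact hσ _ _ hij (Or.inl (by simp))
  | right j =>
    rw [shuffleOfFinset_natAdd]
    refine (congrFun (Finset.orderEmbOfFin_unique hSc
      (f := fun j => σ (Fin.natAdd p j)) (fun j => ?_) fun i j hij => ?_) j).symm
    · simp [leftImage, Fin.ext_iff]
      omega
    · exact hσ _ _ (by simpa using hij) (Or.inr (by simp))

theorem permProd_mul_inv_inv_last {p q : ℕ} (hq : 1 ≤ q) (u : Equiv.Perm (Fin p))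
    (v : Equiv.Perm (Fin q)) (σ : Equiv.Perm (Fin (p + q))) :
    (permProd u v * σ⁻¹)⁻¹ ⟨p + q - 1, by omega⟩ =
      σ (Fin.natAdd p (v⁻¹ ⟨q - 1, by omega⟩)) := by
  have hlast : (⟨p + q - 1, by omega⟩ : Fin (p + q)) = Fin.natAdd p ⟨q - 1, by omega⟩ := by
    ext
    simp
    omega
  rw [mul_inv_rev, inv_inv, Equiv.Perm.mul_apply, EmbeddingLike.apply_eq_iff_eq,
    Equiv.Perm.inv_eq_iff_eq, hlast]
  simp [permProd]

theorem dMul_single_one (x y : DIndex) :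
    dMul (Finsupp.single x 1) (Finsupp.single y 1) = dBasisMul x y := by
  simp [dMul]

/-- The map `θ : SSym → ΔSym`, `θ(F_u) = e^p_{u⁻¹(p)}`, is an algebra
homomorphism: the image of the Malvenuto–Reutenauer product `F_u · F_v` equals
`e^p_{u⁻¹(p)} · e^q_{v⁻¹(q)}` in `ΔSym`.  (Here `Fin n` encodes `{1,…,n}` via `i ↦ i+1`,
so the element `n` is `⟨n−1, _⟩`.) -/
theorem theta_delta_algebra_hom (p q : ℕ) (hp : 1 ≤ p) (hq : 1 ≤ q)
    (u : Equiv.Perm (Fin p)) (v : Equiv.Perm (Fin q)) :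
    ∑ σ ∈ Finset.univ.filter (fun σ : Equiv.Perm (Fin (p + q)) => IsShuffle p q σ),
        Finsupp.single
          (⟨p + q, (permProd u v * σ⁻¹)⁻¹ ⟨p + q - 1, by omega⟩⟩ : DIndex) (1 : ℚ) =
      dMul (Finsupp.single ⟨p, u⁻¹ ⟨p - 1, by omega⟩⟩ 1)
        (Finsupp.single ⟨q, v⁻¹ ⟨q - 1, by omega⟩⟩ 1) := by
  have hcard : ∀ S : Finset (Fin (p + q)), S.card = p → Sᶜ.card = q := fun S hS => by
    simp [Finset.card_compl, hS]
  rw [dMul_single_one, dBasisMul]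
  simp only [permProd_mul_inv_inv_last hq]
  refine Finset.sum_bij' (fun σ _ => ⟨leftImage σ, by simp [card_leftImage]⟩)
    (fun S _ => shuffleOfFinset S.1 (Finset.mem_filter.mp S.2).2
      (hcard _ (Finset.mem_filter.mp S.2).2))
    (fun σ _ => Finset.mem_attach _ _) (fun S _ => ?_) (fun σ hσ => ?_) (fun S _ => ?_)
    (fun σ hσ => ?_)
  · exact Finset.mem_filter.mpr ⟨Finset.mem_univ _, isShuffle_shuffleOfFinset _ _ _⟩
  · exact (Finset.mem_filter.mp hσ).2.eq_shuffleOfFinset _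
  · exact Subtype.ext (leftImage_shuffleOfFinset _ _ _)
  · have h := (Finset.mem_filter.mp hσ).2.eq_shuffleOfFinset (hcard _ (card_leftImage σ))
    conv_lhs => rw [← h, shuffleOfFinset_natAdd]
    simp only [Finset.coe_orderIsoOfFin_apply]
end

section
/- In ΔSym, for all p, q ≥ 1, 1 ≤ j ≤ p and 1 ≤ l ≤ q, the product of basis vectors is given by e^p_j · e^q_l = Σ_{i=l}^{p+l} C(i−1, l−1)·C(p+q−i, q−l)·e^{p+q}_i, where C(·,·) denotes the binomial coefficient. Equivalently, for each i with l ≤ i ≤ p+l, the number of p-element subsets S ⊆ {1,…,p+q} such that the l-th smallest element of {1,…,p+q} ∖ S equals i is C(i−1, l−1)·C(p+q−i, q−l). -/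
/-- An element `i` is the `l`-th entry (counting from zero) of the increasing enumeration of `T`
iff it lies in `T` and has exactly `l` predecessors in `T`. -/
theorem Finset.orderEmbOfFin_eq_iff {α : Type*} [LinearOrder α] {k : ℕ} (T : Finset α)
    (h : T.card = k) (l : Fin k) (i : α) :
    T.orderEmbOfFin h l = i ↔ i ∈ T ∧ (T.filter fun x => x < i).card = l.val := by
  have card_lt (m : Fin k) : (T.filter fun x => x < T.orderEmbOfFin h m).card = m.val := by
    have : (T.filter fun x => x < T.orderEmbOfFin h m) =
        (Finset.Iio m).map (T.orderEmbOfFin h).toEmbedding := by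
      ext x
      simp only [Finset.mem_filter, Finset.mem_map, Finset.mem_Iio, RelEmbedding.coe_toEmbedding]
      constructor
      · rintro ⟨hx, hlt⟩
        obtain ⟨m', rfl⟩ : x ∈ Set.range (T.orderEmbOfFin h) := by
          rwa [Finset.range_orderEmbOfFin]
        exact ⟨m', (T.orderEmbOfFin h).lt_iff_lt.mp hlt, rfl⟩
      · rintro ⟨m', hlt, rfl⟩
        exact ⟨T.orderEmbOfFin_mem h m', (T.orderEmbOfFin h).lt_iff_lt.mpr hlt⟩
    rw [this, Finset.card_map, Fin.card_Iio]
  constructor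
  · rintro rfl
    exact ⟨T.orderEmbOfFin_mem h l, card_lt l⟩
  · rintro ⟨hi, hl⟩
    obtain ⟨m, rfl⟩ : i ∈ Set.range (T.orderEmbOfFin h) := by
      rwa [Finset.range_orderEmbOfFin]
    rw [card_lt m] at hl
    rw [Fin.ext hl]

/-- The number of `p`-element subsets of `Fin (p + q)` whose complement contains `i` with exactly
`l` smaller elements. -/
theorem card_filter_compl_card_lt_eq (p q : ℕ) (l : Fin q) (i : Fin (p + q)) :
    (Finset.univ.filter fun S : Finset (Fin (p + q)) =>
        S.card = p ∧ i ∉ S ∧ (Sᶜ.filter fun x => x < i).card = l.val).card =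
      Nat.choose i.val l.val * Nat.choose (p + q - 1 - i.val) (q - 1 - l.val) := by
  have hl := l.isLt
  rw [← Fin.card_Ioi i, ← Fin.card_Iio i, ← Finset.card_powersetCard,
    ← Finset.card_powersetCard, ← Finset.card_product]
  have split (T : Finset (Fin (p + q))) (hi : i ∈ T) :
      T.card = (T.filter fun x => x < i).card + 1 + (T.filter fun x => i < x).card := by
    have hT : T = insert i ((T.filter fun x => x < i) ∪ (T.filter fun x => i < x)) := by
      ext x
      have := lt_trichotomy x i
      simp only [Finset.mem_insert, Finset.mem_union, Finset.mem_filter]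
      grind
    have hdisj : Disjoint (T.filter fun x => x < i) (T.filter fun x => i < x) := by
      rw [Finset.disjoint_filter]
      exact fun x _ h => h.not_gt
    conv_lhs => rw [hT]
    rw [Finset.card_insert_of_notMem (by simp), Finset.card_union_of_disjoint hdisj]
    omega
  refine Finset.card_nbij'
    (fun S => (Sᶜ.filter fun x => x < i, Sᶜ.filter fun x => i < x))
    (fun A => (insert i (A.1 ∪ A.2))ᶜ) ?_ ?_ ?_ ?_
  · intro S hS
    simp only [Finset.coe_filter, Finset.mem_univ, true_and, Set.mem_ofPred_eq] at hS
    obtain ⟨hc, hi, hlt⟩ := hS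
    have hsplit := split Sᶜ (by simpa using hi)
    rw [Finset.card_compl, Fintype.card_fin] at hsplit
    simp only [Finset.mem_coe, Finset.mem_product, Finset.mem_powersetCard]
    refine ⟨⟨fun x => by simp, hlt⟩, fun x => by simp, ?_⟩
    omega
  · rintro ⟨A, B⟩ hAB
    simp only [Finset.mem_coe, Finset.mem_product, Finset.mem_powersetCard] at hAB
    obtain ⟨⟨hA, hAc⟩, hB, hBc⟩ := hAB
    have hA' (x) (hx : x ∈ A) : x < i := Finset.mem_Iio.mp (hA hx)
    have hB' (x) (hx : x ∈ B) : i < x := Finset.mem_Ioi.mp (hB hx)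
    have hfA : ((insert i (A ∪ B)).filter fun x => x < i) = A := by
      ext x
      simp only [Finset.mem_insert, Finset.mem_union, Finset.mem_filter]
      grind
    have hfB : ((insert i (A ∪ B)).filter fun x => i < x) = B := by
      ext x
      simp only [Finset.mem_insert, Finset.mem_union, Finset.mem_filter]
      grind
    have hsplit := split (insert i (A ∪ B)) (Finset.mem_insert_self _ _)
    rw [hfA, hfB] at hsplit
    simp only [Finset.coe_filter, Finset.mem_univ, true_and, Set.mem_ofPred_eq, compl_compl, hfA]
    refine ⟨?_, by simp, hAc⟩
    rw [Finset.card_compl, Fintype.card_fin]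
    omega
  · intro S hS
    simp only [Finset.coe_filter, Finset.mem_univ, true_and, Set.mem_ofPred_eq] at hS
    ext x
    have := lt_trichotomy x i
    simp only [Finset.mem_compl, Finset.mem_insert, Finset.mem_union, Finset.mem_filter]
    grind
  · rintro ⟨A, B⟩ hAB
    simp only [Finset.mem_coe, Finset.mem_product, Finset.mem_powersetCard] at hAB
    obtain ⟨⟨hA, -⟩, hB, -⟩ := hAB
    have hA' (x) (hx : x ∈ A) : x < i := Finset.mem_Iio.mp (hA hx)
    have hB' (x) (hx : x ∈ B) : i < x := Finset.mem_Ioi.mp (hB hx)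
    simp only [compl_compl, Prod.mk.injEq]
    constructor <;> ext x <;>
      simp only [Finset.mem_insert, Finset.mem_union, Finset.mem_filter] <;> grind

/-- The product formula in `ΔSym`:
`e^p_j · e^q_l = Σ_{i=l}^{p+l} C(i−1, l−1)·C(p+q−i, q−l)·e^{p+q}_i`.  Equivalently, the
number of `p`-element subsets `S ⊆ {1,…,p+q}` whose complement has its `l`-th smallest
element equal to `i` is `C(i−1, l−1)·C(p+q−i, q−l)`.  (Here `Fin n` encodes `{1,…,n}` via
`j ↦ j+1`, so the 1-based indices `j`, `l`, `i` are `j.val+1`, `l.val+1`, `i.val+1`.) -/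
theorem dBasisMul_formula (p q : ℕ) (hp : 1 ≤ p) (hq : 1 ≤ q) (j : Fin p) (l : Fin q) :
    (dBasisMul ⟨p, j⟩ ⟨q, l⟩ =
      ∑ i : Fin (p + q),
        if l.val ≤ i.val ∧ i.val ≤ p + l.val then
          ((Nat.choose i.val l.val * Nat.choose (p + q - 1 - i.val) (q - 1 - l.val) : ℕ) : ℚ) •
            Finsupp.single (⟨p + q, i⟩ : DIndex) (1 : ℚ)
        else 0) ∧
    (∀ i : Fin (p + q), l.val ≤ i.val → i.val ≤ p + l.val →
      (Finset.univ.filter fun S : Finset (Fin (p + q)) =>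
          S.card = p ∧ i ∉ S ∧ (Sᶜ.filter fun x => x < i).card = l.val).card =
        Nat.choose i.val l.val * Nat.choose (p + q - 1 - i.val) (q - 1 - l.val)) := by
  refine ⟨?_, fun i _ _ => card_filter_compl_card_lt_eq p q l i⟩
  have hterm (S : Finset (Fin (p + q))) (h : Sᶜ.card = q) :
      Finsupp.single (⟨p + q, ↑(Sᶜ.orderIsoOfFin h l)⟩ : DIndex) (1 : ℚ) =
        ∑ i : Fin (p + q), if i ∉ S ∧ (Sᶜ.filter fun x => x < i).card = l.val then
          Finsupp.single (⟨p + q, i⟩ : DIndex) (1 : ℚ) else 0 := by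
    simp_rw [← Finset.mem_compl, ← Finset.orderEmbOfFin_eq_iff Sᶜ h l]
    rw [Finset.sum_ite_eq]
    simp
  have hsum : dBasisMul ⟨p, j⟩ ⟨q, l⟩ =
      ∑ S ∈ (Finset.univ.filter fun S : Finset (Fin (p + q)) => S.card = p).attach,
        ∑ i : Fin (p + q), if i ∉ S.1 ∧ (S.1ᶜ.filter fun x => x < i).card = l.val then
          Finsupp.single (⟨p + q, i⟩ : DIndex) (1 : ℚ) else 0 :=
    Finset.sum_congr rfl fun S _ => hterm S.1 _
  rw [hsum, Finset.sum_attach _ fun S : Finset (Fin (p + q)) =>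
    ∑ i : Fin (p + q), if i ∉ S ∧ (Sᶜ.filter fun x => x < i).card = l.val then
      Finsupp.single (⟨p + q, i⟩ : DIndex) (1 : ℚ) else 0, Finset.sum_comm]
  refine Finset.sum_congr rfl fun i _ => ?_
  rw [← Finset.sum_filter, Finset.filter_filter, Finset.sum_const,
    card_filter_compl_card_lt_eq p q l i, ← Nat.cast_smul_eq_nsmul ℚ]
  split_ifs with hi
  · rfl
  · have hl := l.isLt
    have hzero : i.val.choose l.val * (p + q - 1 - i.val).choose (q - 1 - l.val) = 0 := by
      rw [Nat.mul_eq_zero, Nat.choose_eq_zero_iff, Nat.choose_eq_zero_iff]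
      omega
    rw [hzero, Nat.cast_zero, zero_smul]
end

section
/- The product of Δ̃Sym is associative: for all p, q, r ≥ 1 and all A ⊆ {1,…,p}, B ⊆ {1,…,q}, C ⊆ {1,…,r}, one has (F_{p,A} · F_{q,B}) · F_{r,C} = F_{p,A} · (F_{q,B} · F_{r,C}), and associativity also holds when any of the factors is the unit 1 (which is only a one-sided unit). -/
/-- The index set for the basis of `Δ̃Sym`: the basis element `F_{n,A}` is indexed by
`⟨n, A⟩` with `A : Finset (Fin n)` (a subset of `{1,…,n}`); the element `⟨0, ∅⟩` is the
degree-0 basis element `1` (a one-sided unit). -/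
abbrev TIndex : Type := Σ n : ℕ, Finset (Fin n)

/-- The graded vector space `Δ̃Sym`, with degree-`n` basis `{F_{n,A} : A ⊆ {1,…,n}}`. -/
abbrev TSpace : Type := TIndex →₀ ℚ

/-- The product of basis elements: `F_{p,A} · F_{q,B}` is the sum over all `p`-element
subsets `S ⊆ {1,…,p+q}` of `F_{p+q, S ∪ ι̂_S(B)}`, where `ι̂_S : {1,…,q} → {1,…,p+q} ∖ S`
is the order-preserving bijection.  (For `p = 0` this yields `1 · x = x`, and for `q = 0`
it yields `F_{p,A} · 1 = F_{p,{1,…,p}}` and `1 · 1 = 1`.) -/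
noncomputable def tBasisMul (x y : TIndex) : TSpace :=
  ∑ S ∈ (Finset.univ.filter fun S : Finset (Fin (x.1 + y.1)) => S.card = x.1).attach,
    Finsupp.single
      ⟨x.1 + y.1,
        S.1 ∪ Finset.image
          (fun j => (↑((S.1ᶜ).orderIsoOfFin
            (by have h := (Finset.mem_filter.mp S.2).2
                simp [Finset.card_compl, h]) j) : Fin (x.1 + y.1))) y.2⟩ (1 : ℚ)

/-- The bilinear extension of the basis product to all of `Δ̃Sym`. -/
noncomputable def tMul (a b : TSpace) : TSpace :=
  a.sum fun x ca => b.sum fun y cb => (ca * cb) • tBasisMul x y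

open Finset in
/-- The set `S ∪ ι̂_S(B)`, where `ι̂_S` is the order embedding of `Fin m` onto the complement
of `S` (with the junk value `∅` when that complement does not have `m` elements). -/
def unionShift {n m : ℕ} (S : Finset (Fin n)) (B : Finset (Fin m)) : Finset (Fin n) :=
  if h : #Sᶜ = m then S ∪ B.map (Sᶜ.orderEmbOfFin h).toEmbedding else ∅

namespace unionShift

open Finset

variable {n m k : ℕ} {V : Finset (Fin n)}

theorem eq_union (h : #Vᶜ = m) (U : Finset (Fin m)) :
    unionShift V U = V ∪ U.map (Vᶜ.orderEmbOfFin h).toEmbedding :=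
  dif_pos h

theorem disjoint_map (h : #Vᶜ = m) (U : Finset (Fin m)) :
    Disjoint V (U.map (Vᶜ.orderEmbOfFin h).toEmbedding) := by
  rw [Finset.disjoint_left]
  intro x hx hx'
  obtain ⟨j, -, rfl⟩ := Finset.mem_map.mp hx'
  exact Finset.mem_compl.mp (Finset.orderEmbOfFin_mem Vᶜ h j) hx

theorem card_eq (h : #Vᶜ = m) (U : Finset (Fin m)) : #(unionShift V U) = #V + #U := by
  rw [eq_union h, card_union_of_disjoint (disjoint_map h U), card_map]

theorem subset_left (h : #Vᶜ = m) (U : Finset (Fin m)) : V ⊆ unionShift V U := by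
  rw [eq_union h]
  exact subset_union_left

theorem injective (h : #Vᶜ = m) :
    Function.Injective (unionShift V : Finset (Fin m) → Finset (Fin n)) := by
  intro U U' hU
  rw [eq_union h, eq_union h] at hU
  have := congrArg (· \ V) hU
  simp only [union_sdiff_cancel_left (disjoint_map h _)] at this
  exact map_injective _ this

theorem exists_eq (h : #Vᶜ = m) {T : Finset (Fin n)} (hT : V ⊆ T) :
    ∃ U : Finset (Fin m), unionShift V U = T := by
  refine ⟨univ.filter fun j => Vᶜ.orderEmbOfFin h j ∈ T, ?_⟩
  rw [eq_union h]
  ext x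
  simp only [mem_union, mem_map, mem_filter, mem_univ, true_and]
  constructor
  · rintro (hx | ⟨j, hj, rfl⟩)
    · exact hT hx
    · exact hj
  · intro hx
    by_cases hV : x ∈ V
    · exact Or.inl hV
    · have : x ∈ Set.range (Vᶜ.orderEmbOfFin h) := by
        rw [range_orderEmbOfFin]
        simpa using hV
      obtain ⟨j, rfl⟩ := this
      exact Or.inr ⟨j, hx, rfl⟩

theorem card_compl (h : #Vᶜ = m) {U : Finset (Fin m)} (hU : #Uᶜ = k) :
    #(unionShift V U)ᶜ = k := by
  have := card_eq h U
  have h₁ := V.card_add_card_compl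
  have h₂ := U.card_add_card_compl
  have h₃ := (unionShift V U).card_add_card_compl
  simp only [Fintype.card_fin] at h₁ h₂ h₃
  omega

theorem assoc (h : #Vᶜ = m) {U : Finset (Fin m)} (hU : #Uᶜ = k) (C : Finset (Fin k)) :
    unionShift V (unionShift U C) = unionShift (unionShift V U) C := by
  have hUV := card_compl h hU
  have key : (Uᶜ.orderEmbOfFin hU).trans (Vᶜ.orderEmbOfFin h) =
      (unionShift V U)ᶜ.orderEmbOfFin hUV := by
    refine orderEmbOfFin_unique' hUV fun j => ?_
    have h₁ := mem_compl.mp (orderEmbOfFin_mem Vᶜ h (Uᶜ.orderEmbOfFin hU j))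
    have h₂ := mem_compl.mp (orderEmbOfFin_mem Uᶜ hU j)
    rw [mem_compl, eq_union h, mem_union, not_or]
    refine ⟨h₁, fun hj => h₂ ?_⟩
    exact (mem_map' _).mp hj
  rw [eq_union hUV, ← key, eq_union h, eq_union hU, eq_union h, map_union, union_assoc, map_map]
  rfl

theorem sum_powersetCard {M : Type*} [AddCommMonoid M] (h : #Vᶜ = m) (q : ℕ)
    (f : Finset (Fin n) → M) :
    ∑ U ∈ powersetCard q (univ : Finset (Fin m)), f (unionShift V U) =
      ∑ T ∈ powersetCard (#V + q) univ with V ⊆ T, f T := by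
  refine sum_bij (fun U _ => unionShift V U) (fun U hU => ?_)
    (fun U _ U' _ hUU => injective h hUU) (fun T hT => ?_) (fun _ _ => rfl)
  · rw [mem_powersetCard_univ] at hU
    rw [mem_filter, mem_powersetCard_univ, card_eq h, hU]
    exact ⟨rfl, subset_left h U⟩
  · rw [mem_filter, mem_powersetCard_univ] at hT
    obtain ⟨U, rfl⟩ := exists_eq h hT.2
    have := card_eq h U
    exact ⟨U, by rw [mem_powersetCard_univ]; omega, rfl⟩

/-- Both sides sum over the pairs `V ⊆ T` with `V` of size `p` and `T` of size `p + q`. -/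
theorem sum_sum_powersetCard {M : Type*} [AddCommMonoid M] {p : ℕ} (hn : n = p + m) (q : ℕ)
    (f : Finset (Fin n) → M) :
    ∑ U ∈ powersetCard q (univ : Finset (Fin m)), ∑ V ∈ powersetCard p univ,
        f (unionShift V U) =
      (p + q).choose p • ∑ T ∈ powersetCard (p + q) univ, f T := by
  rw [sum_comm, smul_sum]
  calc
    _ = ∑ V ∈ powersetCard p (univ : Finset (Fin n)),
          ∑ T ∈ powersetCard (p + q) univ with V ⊆ T, f T := by
      refine sum_congr rfl fun V hV => ?_
      rw [mem_powersetCard_univ] at hV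
      have h : #Vᶜ = m := by rw [Finset.card_compl, Fintype.card_fin]; omega
      rw [sum_powersetCard h, hV]
    _ = ∑ T ∈ powersetCard (p + q) univ, ∑ _V ∈ powersetCard p T, f T := by
      refine sum_comm' fun V T => ?_
      simp only [mem_filter, mem_powersetCard, subset_univ, true_and]
      tauto
    _ = _ := by
      refine sum_congr rfl fun T hT => ?_
      rw [sum_const, card_powersetCard, mem_powersetCard_univ.mp hT]

end unionShift

open Finset in
theorem tBasisMul_eq_sum {n p q : ℕ} (hn : n = p + q) (A : Finset (Fin p)) (B : Finset (Fin q)) :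
    tBasisMul ⟨p, A⟩ ⟨q, B⟩ =
      ∑ S ∈ powersetCard p (univ : Finset (Fin n)), Finsupp.single ⟨n, unionShift S B⟩ 1 := by
  subst hn
  have hfilter : powersetCard p (univ : Finset (Fin (p + q))) =
      univ.filter fun S => #S = p := by
    ext S
    simp
  rw [hfilter, ← sum_attach]
  refine sum_congr rfl fun S _ => ?_
  have h : #(S.1)ᶜ = q := by
    rw [card_compl, (mem_filter.mp S.2).2, Fintype.card_fin, Nat.add_sub_cancel_left]
  rw [unionShift.eq_union h, map_eq_image]
  rfl

/-- The product of `Δ̃Sym` as a bilinear map. -/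
noncomputable def tMulBilin : TSpace →ₗ[ℚ] TSpace →ₗ[ℚ] TSpace :=
  Finsupp.linearCombination ℚ fun x => Finsupp.linearCombination ℚ (tBasisMul x)

theorem tMul_eq_tMulBilin (a b : TSpace) : tMul a b = tMulBilin a b := by
  simp [tMul, tMulBilin, Finsupp.linearCombination_apply, Finsupp.sum, LinearMap.sum_apply,
    Finset.smul_sum, smul_smul]

theorem tMulBilin_single_single (x y : TIndex) :
    tMulBilin (Finsupp.single x 1) (Finsupp.single y 1) = tBasisMul x y := by
  simp [tMulBilin]

open Finset in
theorem tMulBilin_assoc_single (x y z : TIndex) :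
    tMulBilin (tBasisMul x y) (Finsupp.single z 1) =
      tMulBilin (Finsupp.single x 1) (tBasisMul y z) := by
  obtain ⟨p, A⟩ := x
  obtain ⟨q, B⟩ := y
  obtain ⟨r, C⟩ := z
  rw [tBasisMul_eq_sum rfl A B, tBasisMul_eq_sum rfl B C]
  simp only [map_sum, LinearMap.sum_apply, tMulBilin_single_single]
  simp only [tBasisMul_eq_sum rfl _ C, tBasisMul_eq_sum (Nat.add_assoc p q r) A]
  rw [sum_const, card_powersetCard, card_univ, Fintype.card_fin,
    ← unionShift.sum_sum_powersetCard (Nat.add_assoc p q r)]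
  refine sum_congr rfl fun U hU => sum_congr rfl fun V hV => ?_
  rw [mem_powersetCard_univ] at hU hV
  rw [unionShift.assoc]
  · rw [card_compl, Fintype.card_fin]; omega
  · rw [card_compl, Fintype.card_fin]; omega

theorem tMulBilin_assoc (a b c : TSpace) :
    tMulBilin (tMulBilin a b) c = tMulBilin a (tMulBilin b c) := by
  have single_eq_smul (x : TIndex) (t : ℚ) :
      (Finsupp.single x t : TSpace) = t • Finsupp.single x 1 := by simp
  induction a using Finsupp.induction_linear with
  | zero => simp
  | add a a' ha ha' => simp only [map_add, LinearMap.add_apply, ha, ha']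
  | single x s =>
    induction b using Finsupp.induction_linear with
    | zero => simp
    | add b b' hb hb' => simp only [map_add, LinearMap.add_apply, hb, hb']
    | single y t =>
      induction c using Finsupp.induction_linear with
      | zero => simp
      | add c c' hc hc' => simp only [map_add, hc, hc']
      | single z u =>
        rw [single_eq_smul x, single_eq_smul y, single_eq_smul z]
        simp only [map_smul, LinearMap.smul_apply, tMulBilin_single_single,
          tMulBilin_assoc_single]

/-- The product of `Δ̃Sym` is associative: on all basis elements
`F_{p,A}`, `F_{q,B}`, `F_{r,C}` and also when any factor is the (one-sided) unit
`1 = F_{⟨0,∅⟩}`; hence on all of `Δ̃Sym`. -/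
theorem tMul_assoc :
    (∀ (p q r : ℕ), 1 ≤ p → 1 ≤ q → 1 ≤ r →
      ∀ (A : Finset (Fin p)) (B : Finset (Fin q)) (C : Finset (Fin r)),
        tMul (tMul (Finsupp.single ⟨p, A⟩ 1) (Finsupp.single ⟨q, B⟩ 1))
            (Finsupp.single ⟨r, C⟩ 1) =
          tMul (Finsupp.single ⟨p, A⟩ 1)
            (tMul (Finsupp.single ⟨q, B⟩ 1) (Finsupp.single ⟨r, C⟩ 1))) ∧
    ∀ a b c : TSpace, tMul (tMul a b) c = tMul a (tMul b c) := by
  have assoc (a b c : TSpace) : tMul (tMul a b) c = tMul a (tMul b c) := by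
    simp only [tMul_eq_tMulBilin, tMulBilin_assoc]
  exact ⟨fun _ _ _ _ _ _ _ _ _ => assoc _ _ _, assoc⟩
end

section
/- The product and coproduct of Δ̃Sym are compatible: for all p, q ≥ 1 and all A ⊆ {1,…,p}, B ⊆ {1,…,q}, one has Δ(F_{p,A} · F_{q,B}) = Δ(F_{p,A}) · Δ(F_{q,B}) in Δ̃Sym ⊗ Δ̃Sym, where Δ̃Sym ⊗ Δ̃Sym carries the componentwise product (x ⊗ y)·(x′ ⊗ y′) = (x·x′) ⊗ (y·y′). Hence Δ̃Sym is a graded bialgebra (with one-sided unit). -/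
/-- A model of `Δ̃Sym ⊗ Δ̃Sym`: the free `ℚ`-vector space on pairs of basis indices. -/
abbrev TTSpace : Type := (TIndex × TIndex) →₀ ℚ

/-- The tensor of two elements of `Δ̃Sym`, as an element of `Δ̃Sym ⊗ Δ̃Sym`. -/
noncomputable def tTensor (f g : TSpace) : TTSpace :=
  f.sum fun x c => g.sum fun y d => Finsupp.single (x, y) (c * d)

/-- The componentwise product on `Δ̃Sym ⊗ Δ̃Sym`:
`(x ⊗ y)·(x′ ⊗ y′) = (x·x′) ⊗ (y·y′)`. -/
noncomputable def ttMul (a b : TTSpace) : TTSpace :=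
  a.sum fun xy c => b.sum fun zw d =>
    (c * d) • tTensor (tBasisMul xy.1 zw.1) (tBasisMul xy.2 zw.2)

/-- The coproduct on a basis element:
`Δ(F_{n,A}) = Σ_{i=0}^{n} F_{i, A ∩ {1,…,i}} ⊗ F_{n−i, {a−i : a ∈ A, a > i}}`,
with `F_{0,∅}` read as `1`. -/
noncomputable def tCoprodBasis (x : TIndex) : TTSpace :=
  ∑ i : Fin (x.1 + 1),
    Finsupp.single
      (⟨i.val, Finset.univ.filter fun a : Fin i.val =>
          (⟨a.val, by have h1 := a.isLt; have h2 := i.isLt; omega⟩ : Fin x.1) ∈ x.2⟩,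
       ⟨x.1 - i.val, Finset.univ.filter fun b : Fin (x.1 - i.val) =>
          (⟨b.val + i.val, by have h1 := b.isLt; omega⟩ : Fin x.1) ∈ x.2⟩) (1 : ℚ)

/-- The linear extension of the coproduct to all of `Δ̃Sym`. -/
noncomputable def tCoprod (f : TSpace) : TTSpace :=
  f.sum fun x c => c • tCoprodBasis x

open Classical in
/-- The basis index of degree `n` whose subset of `Fin n` is cut out by a predicate on `ℕ`. -/
noncomputable def TIndex.ofPred (n : ℕ) (P : ℕ → Prop) : TIndex :=
  ⟨n, Finset.univ.filter fun a : Fin n => P a⟩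

theorem TIndex.ofPred_congr {m n : ℕ} {P Q : ℕ → Prop} (hmn : m = n)
    (h : ∀ a < m, (P a ↔ Q a)) : TIndex.ofPred m P = TIndex.ofPred n Q := by
  subst hmn
  unfold TIndex.ofPred
  congr 1
  ext a
  simp [h a a.isLt]

theorem TIndex.exists_eq_ofPred {n : ℕ} (A : Finset (Fin n)) :
    ∃ P : ℕ → Prop, (⟨n, A⟩ : TIndex) = TIndex.ofPred n P := by
  refine ⟨fun a => ∃ h : a < n, (⟨a, h⟩ : Fin n) ∈ A, ?_⟩
  unfold TIndex.ofPred
  congr 1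
  ext a
  simp

/-- Membership in `S ∪ ι̂_S(B)`, where `Q` is membership in `B` and `ι̂_S` enumerates the
complement of `S` in increasing order. -/
def shufflePred (S : Finset ℕ) (Q : ℕ → Prop) (m : ℕ) : Prop :=
  m ∈ S ∨ Q (Nat.count (· ∉ S) m)

/-- The number of elements of `s` below its `j`-th element is `j`. -/
theorem Finset.card_filter_lt_orderEmbOfFin {α : Type*} [LinearOrder α] (s : Finset α) {k : ℕ}
    (h : s.card = k) (j : Fin k) : (s.filter (· < s.orderEmbOfFin h j)).card = j := by
  have : s.filter (· < s.orderEmbOfFin h j) =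
      (Finset.Iio j).map (s.orderEmbOfFin h).toEmbedding := by
    ext x
    simp only [Finset.mem_filter, Finset.mem_map, Finset.mem_Iio,
      RelEmbedding.coe_toEmbedding]
    constructor
    · rintro ⟨hx, hlt⟩
      obtain ⟨i, rfl⟩ : x ∈ Set.range (s.orderEmbOfFin h) := by simpa using hx
      exact ⟨i, by simpa using hlt, rfl⟩
    · rintro ⟨i, hi, rfl⟩
      exact ⟨s.orderEmbOfFin_mem h i, by simpa using hi⟩
  rw [this, Finset.card_map, Fin.card_Iio]

theorem count_notMem_map_valEmbedding {n : ℕ} (S : Finset (Fin n)) (m : Fin n) :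
    Nat.count (· ∉ S.map Fin.valEmbedding) m = (Sᶜ.filter (· < m)).card := by
  rw [Nat.count_eq_card_filter_range, ← Finset.card_map Fin.valEmbedding]
  congr 1
  ext x
  simp only [Finset.mem_filter, Finset.mem_range, Finset.mem_map, Finset.mem_compl,
    Fin.valEmbedding_apply]
  constructor
  · rintro ⟨hx, hS⟩
    exact ⟨⟨x, hx.trans m.isLt⟩, ⟨fun h => hS ⟨_, h, rfl⟩, hx⟩, rfl⟩
  · rintro ⟨y, ⟨hy, hlt⟩, rfl⟩
    exact ⟨hlt, fun ⟨z, hz, e⟩ => hy (Fin.ext e ▸ hz)⟩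

open Classical in
theorem shufflePred_map_valEmbedding {n q : ℕ} (S : Finset (Fin n)) (h : Sᶜ.card = q)
    (Q : ℕ → Prop) (m : Fin n) :
    shufflePred (S.map Fin.valEmbedding) Q m ↔
      m ∈ S ∪ Finset.image (fun j => (Sᶜ.orderIsoOfFin h j : Fin n))
        (Finset.univ.filter fun b : Fin q => Q b) := by
  by_cases hm : m ∈ S
  · have hm' : (m : ℕ) ∈ S.map Fin.valEmbedding := by simpa [Fin.val_inj] using hm
    exact iff_of_true (Or.inl hm') (Finset.mem_union_left _ hm)
  · obtain ⟨j, rfl⟩ : m ∈ Set.range (Sᶜ.orderEmbOfFin h) := by simpa using hm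
    have hc := count_notMem_map_valEmbedding S (Sᶜ.orderEmbOfFin h j)
    rw [Finset.card_filter_lt_orderEmbOfFin] at hc
    have hmem : ¬ ((Sᶜ.orderEmbOfFin h j : Fin n) : ℕ) ∈ S.map Fin.valEmbedding := by
      simpa [Fin.val_inj] using hm
    have hQ : shufflePred (S.map Fin.valEmbedding) Q (Sᶜ.orderEmbOfFin h j) ↔ Q j := by
      unfold shufflePred
      rw [or_iff_right hmem, hc]
    rw [hQ, Finset.mem_union, or_iff_right hm]
    simp only [Finset.coe_orderIsoOfFin_apply, Finset.mem_image, Finset.mem_filter,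
      Finset.mem_univ, true_and, (Sᶜ.orderEmbOfFin h).injective.eq_iff, exists_eq_right]

theorem tBasisMul_ofPred (p q : ℕ) (P Q : ℕ → Prop) :
    tBasisMul (TIndex.ofPred p P) (TIndex.ofPred q Q) =
      ∑ S ∈ (Finset.range (p + q)).powersetCard p,
        Finsupp.single (TIndex.ofPred (p + q) (shufflePred S Q)) (1 : ℚ) := by
  classical
  unfold tBasisMul
  refine Finset.sum_bij (fun S _ => S.1.map Fin.valEmbedding) ?_ ?_ ?_ ?_
  · rintro ⟨S, hS⟩ -
    rw [Finset.mem_powersetCard, Finset.card_map]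
    refine ⟨fun x hx => ?_, (Finset.mem_filter.mp hS).2⟩
    obtain ⟨y, -, rfl⟩ := Finset.mem_map.mp hx
    exact Finset.mem_range.mpr y.isLt
  · rintro ⟨S, hS⟩ - ⟨T, hT⟩ - h
    exact Subtype.ext (Finset.map_injective _ h)
  · intro T hT
    rw [Finset.mem_powersetCard] at hT
    have hlt : ∀ x ∈ T, x < p + q := fun x hx => Finset.mem_range.mp (hT.1 hx)
    have hmap : (T.attachFin hlt).map Fin.valEmbedding = T := by
      simp
    refine ⟨⟨T.attachFin hlt, ?_⟩, Finset.mem_attach _ _, hmap⟩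
    rw [Finset.mem_filter]
    exact ⟨Finset.mem_univ _, (Finset.card_attachFin T hlt).trans hT.2⟩
  · rintro ⟨S, hS⟩ -
    congr 1
    refine Sigma.ext rfl (heq_of_eq (Finset.ext fun m => ?_))
    have hc : Sᶜ.card = q := by
      have h : S.card = p := (Finset.mem_filter.mp hS).2
      rw [Finset.card_compl, h, Fintype.card_fin]
      exact Nat.add_sub_cancel_left p q
    exact (shufflePred_map_valEmbedding (n := p + q) S hc Q m).symm.trans
      (Finset.mem_filter_univ (p := fun a : Fin (p + q) =>
        shufflePred (S.map Fin.valEmbedding) Q a) m).symm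

theorem tCoprodBasis_ofPred (n : ℕ) (P : ℕ → Prop) :
    tCoprodBasis (TIndex.ofPred n P) =
      ∑ i ∈ Finset.range (n + 1),
        Finsupp.single (TIndex.ofPred i P, TIndex.ofPred (n - i) fun b => P (b + i)) (1 : ℚ) := by
  classical
  unfold tCoprodBasis
  rw [← Fin.sum_univ_eq_sum_range
    (fun i => Finsupp.single (TIndex.ofPred i P, TIndex.ofPred (n - i) fun b => P (b + i)) (1 : ℚ))]
  refine Finset.sum_congr rfl fun i _ => ?_
  congr 2 <;>
  · refine Sigma.ext rfl (heq_of_eq (Finset.filter_congr fun a _ => ?_))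
    exact Finset.mem_filter_univ (p := fun a : Fin n => P a) _

theorem tCoprod_single (x : TIndex) : tCoprod (Finsupp.single x 1) = tCoprodBasis x := by
  simp [tCoprod]

theorem tMul_single (x y : TIndex) :
    tMul (Finsupp.single x 1) (Finsupp.single y 1) = tBasisMul x y := by
  simp [tMul]

theorem tCoprod_sum_single {ι : Type*} (s : Finset ι) (f : ι → TIndex) :
    tCoprod (∑ i ∈ s, Finsupp.single (f i) 1) = ∑ i ∈ s, tCoprodBasis (f i) := by
  unfold tCoprod
  rw [← Finsupp.sum_finsetSum_index (by simp) (by simp [add_smul])]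
  simp

theorem tTensor_sum_single {ι κ : Type*} (s : Finset ι) (t : Finset κ) (f : ι → TIndex)
    (g : κ → TIndex) :
    tTensor (∑ i ∈ s, Finsupp.single (f i) 1) (∑ j ∈ t, Finsupp.single (g j) 1) =
      ∑ i ∈ s, ∑ j ∈ t, Finsupp.single (f i, g j) 1 := by
  unfold tTensor
  rw [← Finsupp.sum_finsetSum_index (by simp)
    (by simp [add_mul, Finsupp.single_add, Finsupp.sum_add])]
  refine Finset.sum_congr rfl fun i _ => ?_
  rw [Finsupp.sum_single_index (by simp),
    ← Finsupp.sum_finsetSum_index (by simp) (by simp [mul_add, Finsupp.single_add])]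
  simp

theorem ttMul_sum_single {ι κ : Type*} (s : Finset ι) (t : Finset κ) (f : ι → TIndex × TIndex)
    (g : κ → TIndex × TIndex) :
    ttMul (∑ i ∈ s, Finsupp.single (f i) 1) (∑ j ∈ t, Finsupp.single (g j) 1) =
      ∑ i ∈ s, ∑ j ∈ t,
        tTensor (tBasisMul (f i).1 (g j).1) (tBasisMul (f i).2 (g j).2) := by
  unfold ttMul
  rw [← Finsupp.sum_finsetSum_index (by simp)
    (by simp [add_mul, add_smul, Finsupp.sum_add])]
  refine Finset.sum_congr rfl fun i _ => ?_
  rw [Finsupp.sum_single_index (by simp),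
    ← Finsupp.sum_finsetSum_index (by simp) (by simp [mul_add, add_smul])]
  simp

/-- The elements of `S` that are at least `i`, shifted down by `i`. -/
def Finset.dropBelow (S : Finset ℕ) (i : ℕ) : Finset ℕ :=
  (S.filter (i ≤ ·)).image (· - i)

theorem Finset.mem_dropBelow {S : Finset ℕ} {i x : ℕ} : x ∈ S.dropBelow i ↔ x + i ∈ S := by
  simp only [Finset.dropBelow, Finset.mem_image, Finset.mem_filter]
  constructor
  · rintro ⟨y, ⟨hy, hi⟩, rfl⟩
    rwa [Nat.sub_add_cancel hi]
  · intro h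
    exact ⟨x + i, ⟨h, by omega⟩, by omega⟩

theorem Finset.card_filter_lt_add_card_dropBelow (S : Finset ℕ) (i : ℕ) :
    (S.filter (· < i)).card + (S.dropBelow i).card = S.card := by
  have h : (S.dropBelow i).card = (S.filter (i ≤ ·)).card := by
    refine Finset.card_image_of_injOn fun x hx y hy hxy => ?_
    simp only [Finset.coe_filter, Set.mem_ofPred_eq] at hx hy hxy
    omega
  rw [h, ← Finset.card_filter_add_card_filter_not (s := S) (· < i)]
  simp

/-- A set of naturals of size `p` in `[0, p + q)` has at most `p` and at most `i` elements below
`i`, and at most `q` non-elements below `i`. -/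
theorem Finset.card_filter_lt_bounds {p q i : ℕ} {S : Finset ℕ}
    (hS : S ∈ (Finset.range (p + q)).powersetCard p) (hi : i ≤ p + q) :
    (S.filter (· < i)).card ≤ p ∧ (S.filter (· < i)).card ≤ i ∧
      i ≤ q + (S.filter (· < i)).card := by
  rw [Finset.mem_powersetCard] at hS
  have h1 : (S.filter (· < i)).card ≤ (Finset.range i).card :=
    Finset.card_le_card fun x hx => by simp_all
  have h2 : (S.dropBelow i).card ≤ (Finset.range (p + q - i)).card :=
    Finset.card_le_card fun x hx => by
      have := Finset.mem_range.mp (hS.1 (Finset.mem_dropBelow.mp hx))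
      rw [Finset.mem_range]
      omega
  have h3 := S.card_filter_lt_add_card_dropBelow i
  rw [Finset.card_range] at h1 h2
  omega

theorem shufflePred_filter_lt (S : Finset ℕ) (Q : ℕ → Prop) {i m : ℕ} (hm : m < i) :
    shufflePred (S.filter (· < i)) Q m ↔ shufflePred S Q m := by
  unfold shufflePred
  have hc : Nat.count (· ∉ S.filter (· < i)) m = Nat.count (· ∉ S) m := by
    simp only [Nat.count_eq_card_filter_range]
    congr 1
    ext x
    simp only [Finset.mem_filter, Finset.mem_range, not_and, and_congr_right_iff]
    intro hx
    have : x < i := hx.trans hm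
    tauto
  have hm' : m ∈ S.filter (· < i) ↔ m ∈ S := by simp [hm]
  rw [hm', hc]

theorem card_filter_lt_add_count_notMem (S : Finset ℕ) (i : ℕ) :
    (S.filter (· < i)).card + Nat.count (· ∉ S) i = i := by
  rw [Nat.count_eq_card_filter_range]
  have : S.filter (· < i) = (Finset.range i).filter (· ∈ S) := by
    ext x
    simp [and_comm]
  rw [this, Finset.card_filter_add_card_filter_not, Finset.card_range]

theorem shufflePred_dropBelow (S : Finset ℕ) (Q : ℕ → Prop) (i m : ℕ) :
    shufflePred (S.dropBelow i) (fun b => Q (b + (i - (S.filter (· < i)).card))) m ↔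
      shufflePred S Q (m + i) := by
  unfold shufflePred
  have hi := card_filter_lt_add_count_notMem S i
  have hc : Nat.count (· ∉ S.dropBelow i) m + (i - (S.filter (· < i)).card) =
      Nat.count (· ∉ S) (m + i) := by
    rw [add_comm m i, Nat.count_add]
    simp only [Finset.mem_dropBelow, add_comm i]
    omega
  simp only [Finset.mem_dropBelow, ← hc]

/-- Cutting a `p`-subset of `[0, p + q)` at a position `i` is the same as choosing `j ≤ p`,
`k ≤ q`, a `j`-subset of `[0, j + k)` and a `(p - j)`-subset of `[0, (p - j) + (q - k))`. -/
theorem sum_powersetCard_sum_cut {M : Type*} [AddCommMonoid M] (p q : ℕ)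
    (f : ℕ → ℕ → Finset ℕ → Finset ℕ → M) :
    ∑ S ∈ (Finset.range (p + q)).powersetCard p, ∑ i ∈ Finset.range (p + q + 1),
        f (S.filter (· < i)).card (i - (S.filter (· < i)).card) (S.filter (· < i))
          (S.dropBelow i) =
      ∑ j ∈ Finset.range (p + 1), ∑ k ∈ Finset.range (q + 1),
        ∑ S ∈ (Finset.range (j + k)).powersetCard j,
          ∑ T ∈ (Finset.range (p - j + (q - k))).powersetCard (p - j), f j k S T := by
  simp only [Finset.sum_sigma']
  refine Finset.sum_bij'
    (fun x _ => ⟨(x.1.filter (· < x.2)).card, x.2 - (x.1.filter (· < x.2)).card,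
      x.1.filter (· < x.2), x.1.dropBelow x.2⟩)
    (fun y _ => ⟨y.2.2.1 ∪ y.2.2.2.image (· + (y.1 + y.2.1)), y.1 + y.2.1⟩) ?_ ?_ ?_ ?_ ?_
  · rintro ⟨S, i⟩ h
    simp only [Finset.mem_sigma, Finset.mem_range] at h ⊢
    obtain ⟨hS, hi⟩ := h
    have hb := Finset.card_filter_lt_bounds hS (Nat.lt_succ_iff.mp hi)
    have hc := S.card_filter_lt_add_card_dropBelow i
    rw [Finset.mem_powersetCard] at hS
    refine ⟨by omega, by omega, ?_, ?_⟩
    · rw [Finset.mem_powersetCard]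
      refine ⟨fun x hx => ?_, rfl⟩
      have := (Finset.mem_filter.mp hx).2
      rw [Finset.mem_range]
      omega
    · rw [Finset.mem_powersetCard]
      refine ⟨fun x hx => ?_, by omega⟩
      have := Finset.mem_range.mp (hS.1 (Finset.mem_dropBelow.mp hx))
      rw [Finset.mem_range]
      omega
  · rintro ⟨j, k, S, T⟩ h
    simp only [Finset.mem_sigma, Finset.mem_range, Finset.mem_powersetCard] at h ⊢
    obtain ⟨hj, hk, ⟨hS, hSc⟩, hT, hTc⟩ := h
    refine ⟨⟨fun x hx => ?_, ?_⟩, by omega⟩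
    · rw [Finset.mem_range]
      rcases Finset.mem_union.mp hx with hx | hx
      · have := Finset.mem_range.mp (hS hx)
        omega
      · obtain ⟨y, hy, rfl⟩ := Finset.mem_image.mp hx
        have := Finset.mem_range.mp (hT hy)
        omega
    · rw [Finset.card_union_of_disjoint, Finset.card_image_of_injective _ (add_left_injective _)]
      · omega
      · rw [Finset.disjoint_left]
        intro x hx hx'
        obtain ⟨y, hy, rfl⟩ := Finset.mem_image.mp hx'
        have := Finset.mem_range.mp (hS hx)
        omega
  · rintro ⟨S, i⟩ h
    simp only [Finset.mem_sigma, Finset.mem_range] at h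
    have hb := Finset.card_filter_lt_bounds h.1 (Nat.lt_succ_iff.mp h.2)
    have hi : (S.filter (· < i)).card + (i - (S.filter (· < i)).card) = i := by omega
    simp only [hi, Sigma.mk.injEq, heq_eq_eq, and_true]
    ext x
    simp only [Finset.mem_union, Finset.mem_filter, Finset.mem_image, Finset.mem_dropBelow]
    constructor
    · rintro (hx | ⟨y, hy, rfl⟩)
      exacts [hx.1, hy]
    · intro hx
      rcases lt_or_ge x i with hlt | hge
      · exact Or.inl ⟨hx, hlt⟩
      · exact Or.inr ⟨x - i, by rwa [Nat.sub_add_cancel hge], Nat.sub_add_cancel hge⟩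
  · rintro ⟨j, k, S, T⟩ h
    simp only [Finset.mem_sigma, Finset.mem_range, Finset.mem_powersetCard] at h
    obtain ⟨hj, hk, ⟨hS, hSc⟩, hT, hTc⟩ := h
    have hlt : ∀ x ∈ S, x < j + k := fun x hx => Finset.mem_range.mp (hS hx)
    have h1 : (S ∪ T.image (· + (j + k))).filter (· < j + k) = S := by
      ext x
      simp only [Finset.mem_union, Finset.mem_filter, Finset.mem_image]
      constructor
      · rintro ⟨hx | ⟨y, hy, rfl⟩, hx'⟩
        · exact hx
        · omega
      · exact fun hx => ⟨Or.inl hx, hlt x hx⟩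
    have h2 : (S ∪ T.image (· + (j + k))).dropBelow (j + k) = T := by
      ext x
      simp only [Finset.mem_dropBelow, Finset.mem_union, Finset.mem_image]
      constructor
      · rintro (hx | ⟨y, hy, hxy⟩)
        · have := hlt _ hx
          omega
        · rwa [← Nat.add_right_cancel hxy]
      · exact fun hx => Or.inr ⟨x, hx, rfl⟩
    simp only [h1, h2, hSc, Nat.add_sub_cancel_left]
  · rintro ⟨S, i⟩ h
    rfl

/-- The product and coproduct of `Δ̃Sym` are compatible:
`Δ(F_{p,A} · F_{q,B}) = Δ(F_{p,A}) · Δ(F_{q,B})`, the tensor square carrying the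
componentwise product.  Hence `Δ̃Sym` is a graded bialgebra (with one-sided unit). -/
theorem tCoprod_tMul (p q : ℕ) (hp : 1 ≤ p) (hq : 1 ≤ q)
    (A : Finset (Fin p)) (B : Finset (Fin q)) :
    tCoprod (tMul (Finsupp.single ⟨p, A⟩ 1) (Finsupp.single ⟨q, B⟩ 1)) =
      ttMul (tCoprod (Finsupp.single ⟨p, A⟩ 1)) (tCoprod (Finsupp.single ⟨q, B⟩ 1)) := by
  obtain ⟨P, hP⟩ := TIndex.exists_eq_ofPred A
  obtain ⟨Q, hQ⟩ := TIndex.exists_eq_ofPred B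
  rw [hP, hQ, tMul_single, tCoprod_single, tCoprod_single, tBasisMul_ofPred, tCoprod_sum_single,
    tCoprodBasis_ofPred, tCoprodBasis_ofPred, ttMul_sum_single]
  simp only [tBasisMul_ofPred, tTensor_sum_single, tCoprodBasis_ofPred]
  rw [← sum_powersetCard_sum_cut p q fun j k S T => Finsupp.single
    (TIndex.ofPred (j + k) (shufflePred S Q),
      TIndex.ofPred (p - j + (q - k)) (shufflePred T fun b => Q (b + k))) (1 : ℚ)]
  refine Finset.sum_congr rfl fun S hS => Finset.sum_congr rfl fun i hi => ?_
  have hb := Finset.card_filter_lt_bounds hS (Nat.lt_succ_iff.mp (Finset.mem_range.mp hi))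
  rw [Finset.mem_range] at hi
  congr 2
  · exact TIndex.ofPred_congr (by omega) fun a ha => (shufflePred_filter_lt S Q ha).symm
  · exact TIndex.ofPred_congr (by omega) fun a _ => (shufflePred_dropBelow S Q i a).symm
end
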